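/- Four-step (blocked) evaluation of FFT-based convolution: let r, m ≥ 1 and n = r·m. Then for all g, x ∈ ℂⁿ (0-based indices) and all 0 ≤ a < r, 0 ≤ b < m: (conj(F_n) · (g ∘ (F_n · x)))(a + r·b) = Σ_{j=0}^{m−1} Σ_{l=0}^{r−1} conj(ω_n^{a·j} · ω_r^{a·l} · ω_m^{j·b}) · g(j + m·l) · ( Σ_{u=0}^{r−1} Σ_{v=0}^{m−1} ω_n^{j·u} · ω_r^{u·l} · ω_m^{j·v} · x(u + r·v) ). Dividing both sides by n identifies the left-hand side with the discrete convolution F_n⁻¹ · (g ∘ (F_n · x)), since F_n⁻¹ = (1/n) • conj(F_n). -/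

import Mathlib

open Matrix Complex

/-- The primitive root `ω_n = exp(−2πi/n)`. -/
noncomputable def ω (n : ℕ) : ℂ := Complex.exp (-(2 * Real.pi * Complex.I) / n)

/-- The `n × n` DFT matrix with 0-based entries `(F_n)_{jk} = ω_n^{j·k}`. -/
noncomputable def dftMatrix (n : ℕ) : Matrix (Fin n) (Fin n) ℂ :=
  fun j k => ω n ^ (j.val * k.val)

/-- The index `a + r·b` of `{0,…,r·m−1}`, for `a < r` and `b < m`. -/
def idxRM (r m : ℕ) (a : Fin r) (b : Fin m) : Fin (r * m) :=
  ⟨a.val + r * b.val, by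
    have h1 : a.val + r * b.val < r * (b.val + 1) := by
      rw [Nat.mul_succ]; have := a.isLt; omega
    have h2 : r * (b.val + 1) ≤ r * m :=
      Nat.mul_le_mul (Nat.le_refl r) (by have := b.isLt; omega)
    exact lt_of_lt_of_le h1 h2⟩

/-- The index `j + m·l` of `{0,…,r·m−1}`, for `j < m` and `l < r`. -/
def idxMR (r m : ℕ) (j : Fin m) (l : Fin r) : Fin (r * m) :=
  ⟨j.val + m * l.val, by
    have h1 : j.val + m * l.val < m * (l.val + 1) := by
      rw [Nat.mul_succ]; have := j.isLt; omega
    have h2 : m * (l.val + 1) ≤ m * r :=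
      Nat.mul_le_mul (Nat.le_refl m) (by have := l.isLt; omega)
    calc j.val + m * l.val < m * (l.val + 1) := h1
      _ ≤ m * r := h2
      _ = r * m := Nat.mul_comm m r⟩

theorem omega_isPrimitiveRoot {n : ℕ} (hn : n ≠ 0) : IsPrimitiveRoot (ω n) n := by
  have h := (Complex.isPrimitiveRoot_exp n hn).inv
  rwa [← Complex.exp_neg, ← neg_div] at h

theorem conj_omega_mul_self (n : ℕ) : (starRingEnd ℂ) (ω n) * ω n = 1 := by
  rw [ω, ← Complex.exp_conj, ← Complex.exp_add, ← Complex.exp_zero]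
  congr 1
  simp [neg_div, Complex.conj_ofNat]

theorem omega_mul_pow_left {r : ℕ} (m : ℕ) (hr : r ≠ 0) : ω (r * m) ^ r = ω m := by
  rw [ω, ω, ← Complex.exp_nat_mul]
  congr 1
  have : (r : ℂ) ≠ 0 := Nat.cast_ne_zero.mpr hr
  push_cast
  rw [← mul_div_assoc, mul_div_mul_left _ _ this]

theorem omega_mul_pow_right (r : ℕ) {m : ℕ} (hm : m ≠ 0) : ω (r * m) ^ m = ω r := by
  rw [mul_comm r m, omega_mul_pow_left r hm]

theorem dftMatrix_idxMR_idxRM {r m : ℕ} (j : Fin m) (l : Fin r) (u : Fin r) (v : Fin m) :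
    dftMatrix (r * m) (idxMR r m j l) (idxRM r m u v) =
      ω (r * m) ^ (j.val * u.val) * ω r ^ (u.val * l.val) * ω m ^ (j.val * v.val) := by
  have hr : r ≠ 0 := u.pos.ne'
  have hm : m ≠ 0 := v.pos.ne'
  have key : (j.val + m * l.val) * (u.val + r * v.val) = j.val * u.val + m * (u.val * l.val) +
      r * (j.val * v.val) + r * m * (l.val * v.val) := by ring
  simp only [dftMatrix, idxMR, idxRM]
  rw [key, pow_add, pow_add, pow_add, pow_mul _ m, pow_mul _ r, pow_mul _ (r * m),
    omega_mul_pow_left m hr, omega_mul_pow_right r hm,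
    (omega_isPrimitiveRoot (mul_ne_zero hr hm)).pow_eq_one, one_pow, mul_one]

theorem dftMatrix_apply_comm {n : ℕ} (i j : Fin n) : dftMatrix n i j = dftMatrix n j i := by
  rw [dftMatrix, dftMatrix, mul_comm]

theorem sum_idxMR {M : Type*} [AddCommMonoid M] {r m : ℕ} (f : Fin (r * m) → M) :
    ∑ i, f i = ∑ j : Fin m, ∑ l : Fin r, f (idxMR r m j l) := by
  rw [← finProdFinEquiv.sum_comp f, Fintype.sum_prod_type, Finset.sum_comm]
  rfl

theorem sum_idxRM {M : Type*} [AddCommMonoid M] {r m : ℕ} (f : Fin (r * m) → M) :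
    ∑ i, f i = ∑ u : Fin r, ∑ v : Fin m, f (idxRM r m u v) := by
  rw [← (finCongr (mul_comm m r)).sum_comp f, sum_idxMR]
  rfl

theorem conj_dftMatrix_mul_dftMatrix (n : ℕ) :
    (dftMatrix n).map (starRingEnd ℂ) * dftMatrix n = (n : ℂ) • (1 : Matrix (Fin n) (Fin n) ℂ) := by
  ext i j
  have hprim := omega_isPrimitiveRoot i.pos.ne'
  have hconj := conj_omega_mul_self n
  set z : ℂ := (starRingEnd ℂ) (ω n) ^ i.val * ω n ^ j.val with hz
  have hsum : ((dftMatrix n).map (starRingEnd ℂ) * dftMatrix n) i j =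
      ∑ k ∈ Finset.range n, z ^ k := by
    rw [Matrix.mul_apply, Finset.sum_range]
    refine Finset.sum_congr rfl fun k _ => ?_
    simp only [Matrix.map_apply, dftMatrix, map_pow, hz]
    rw [mul_pow, ← pow_mul, ← pow_mul, mul_comm k.val]
  rw [hsum, Matrix.smul_apply, smul_eq_mul]
  by_cases hij : i = j
  · subst hij
    have hz1 : z = 1 := by rw [hz, ← mul_pow, hconj, one_pow]
    simp [hz1]
  · have hz1 : z ≠ 1 := by
      intro h
      refine hij (Fin.ext (hprim.pow_inj i.isLt j.isLt ?_))
      calc ω n ^ i.val = ω n ^ i.val * z := by rw [h, mul_one]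
        _ = ((starRingEnd ℂ) (ω n) * ω n) ^ i.val * ω n ^ j.val := by rw [hz]; ring
        _ = ω n ^ j.val := by rw [hconj, one_pow, one_mul]
    have hzn : z ^ n = 1 := by
      rw [hz, mul_pow, ← pow_mul, ← pow_mul, mul_comm i.val, mul_comm j.val, pow_mul, pow_mul,
        ← map_pow, hprim.pow_eq_one]
      simp
    rw [geom_sum_eq hz1, hzn, Matrix.one_apply_ne hij]
    simp

theorem inv_dftMatrix (n : ℕ) :
    (dftMatrix n)⁻¹ = ((1 : ℂ) / n) • (dftMatrix n).map (starRingEnd ℂ) := by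
  rcases eq_or_ne n 0 with rfl | hn
  · exact Subsingleton.elim _ _
  · apply Matrix.inv_eq_left_inv
    rw [Matrix.smul_mul, conj_dftMatrix_mul_dftMatrix, smul_smul,
      one_div_mul_cancel (Nat.cast_ne_zero.mpr hn), one_smul]

theorem conj_dftMatrix_mulVec_idxRM {r m : ℕ} (g x : Fin (r * m) → ℂ) (a : Fin r) (b : Fin m) :
    ((dftMatrix (r * m)).map (starRingEnd ℂ)).mulVec
        (fun i => g i * (dftMatrix (r * m)).mulVec x i) (idxRM r m a b)
      = ∑ j : Fin m, ∑ l : Fin r,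
          (starRingEnd ℂ) (ω (r * m) ^ (a.val * j.val) * ω r ^ (a.val * l.val) *
              ω m ^ (j.val * b.val)) *
            g (idxMR r m j l) *
            (∑ u : Fin r, ∑ v : Fin m,
              ω (r * m) ^ (j.val * u.val) * ω r ^ (u.val * l.val) *
                ω m ^ (j.val * v.val) * x (idxRM r m u v)) := by
  simp only [Matrix.mulVec, dotProduct]
  rw [sum_idxMR]
  refine Finset.sum_congr rfl fun j _ => Finset.sum_congr rfl fun l _ => ?_
  rw [sum_idxRM, Matrix.map_apply, dftMatrix_apply_comm, ← mul_assoc]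
  simp only [dftMatrix_idxMR_idxRM]
  rw [mul_comm a.val j.val]

/-- Four-step (blocked) evaluation of FFT-based convolution: for `n = r·m`, `a < r`, `b < m`,
`(conj(F_n) · (g ∘ (F_n·x)))(a + r·b)` equals the blocked double sum below; dividing by `n`
identifies the left-hand side with the discrete convolution `F_n⁻¹ · (g ∘ (F_n·x))`,
since `F_n⁻¹ = (1/n) • conj(F_n)`. -/
theorem stmt16 (r m : ℕ) (hr : 1 ≤ r) (hm : 1 ≤ m)
    (g x : Fin (r * m) → ℂ) (a : Fin r) (b : Fin m) :
    ((dftMatrix (r * m)).map (starRingEnd ℂ)).mulVec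
        (fun i => g i * (dftMatrix (r * m)).mulVec x i) (idxRM r m a b)
      = ∑ j : Fin m, ∑ l : Fin r,
          (starRingEnd ℂ) (ω (r * m) ^ (a.val * j.val) * ω r ^ (a.val * l.val) *
              ω m ^ (j.val * b.val)) *
            g (idxMR r m j l) *
            (∑ u : Fin r, ∑ v : Fin m,
              ω (r * m) ^ (j.val * u.val) * ω r ^ (u.val * l.val) *
                ω m ^ (j.val * v.val) * x (idxRM r m u v)) ∧
    (dftMatrix (r * m))⁻¹.mulVec
        (fun i => g i * (dftMatrix (r * m)).mulVec x i) (idxRM r m a b)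
      = ((1 : ℂ) / ((r : ℂ) * (m : ℂ))) *
          ∑ j : Fin m, ∑ l : Fin r,
            (starRingEnd ℂ) (ω (r * m) ^ (a.val * j.val) * ω r ^ (a.val * l.val) *
                ω m ^ (j.val * b.val)) *
              g (idxMR r m j l) *
              (∑ u : Fin r, ∑ v : Fin m,
                ω (r * m) ^ (j.val * u.val) * ω r ^ (u.val * l.val) *
                  ω m ^ (j.val * v.val) * x (idxRM r m u v)) := by
  refine ⟨conj_dftMatrix_mulVec_idxRM g x a b, ?_⟩
  rw [inv_dftMatrix, Matrix.smul_mulVec, Pi.smul_apply, conj_dftMatrix_mulVec_idxRM, smul_eq_mul,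
    Nat.cast_mul]
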